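/- Let k ≥ 2 be an integer, t₀ ∈ (0,1), and let u : (0,1) → ℝ be a function whose restrictions to (0,t₀) and (t₀,1) extend to C^∞ functions on [0,t₀] and [t₀,1] respectively, with one-sided limits u(t₀−) ≠ u(t₀+) and with all one-sided derivatives of order ℓ ≥ 1 equal to 0 at t₀ from both sides. Then for every δ > 0 there exists a family (u_ε)_{ε ∈ (0,1)} of C^∞ functions on (0,1) such that ∫_0^1 |u_ε − u| dt → 0 as ε → 0 and limsup_{ε→0} F_ε(u_ε; (0,1)) ≤ m_k |u(t₀+) − u(t₀−)|^{1/k} + ∫_0^1 (u'(t))² dt + δ. -/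

import Mathlib

open MeasureTheory Set Filter

/-- The energy `F_ε(u; (0,1)) = ∫_0^1 min{(u')², 1/ε} + ε^{2k-1} ∫_0^1 (u^{(k)})²`. -/
noncomputable def Fe (k : ℕ) (ε : ℝ) (u : ℝ → ℝ) : ℝ :=
  (∫ t in Ioo (0:ℝ) 1, min ((deriv u t) ^ 2) (1 / ε)) +
    ε ^ (2 * k - 1) * ∫ t in Ioo (0:ℝ) 1, (iteratedDeriv k u t) ^ 2

/-- The admissible energies defining the optimal-profile constant `m_k`: values
`T + ∫_{-T/2}^{T/2} (v^{(k)})²` over `T > 0` and `k` times continuously differentiable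
`v : [-T/2, T/2] → ℝ` with `v(∓T/2) = ∓1/2` and `v^{(ℓ)}(±T/2) = 0` for `ℓ ∈ {1,…,k-1}`;
`m_k` is the infimum of this set. -/
def mkSet (k : ℕ) : Set ℝ :=
  {E : ℝ | ∃ T : ℝ, 0 < T ∧ ∃ v : ℝ → ℝ,
    ContDiffOn ℝ k v (Icc (-(T/2)) (T/2)) ∧
    v (-(T/2)) = -(1/2) ∧ v (T/2) = 1/2 ∧
    (∀ ℓ : ℕ, 1 ≤ ℓ → ℓ ≤ k - 1 →
      iteratedDerivWithin ℓ v (Icc (-(T/2)) (T/2)) (-(T/2)) = 0 ∧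
      iteratedDerivWithin ℓ v (Icc (-(T/2)) (T/2)) (T/2) = 0) ∧
    E = T + ∫ t in Icc (-(T/2)) (T/2),
      (iteratedDerivWithin k v (Icc (-(T/2)) (T/2)) t) ^ 2}

lemma aux_conv_deriv {ρ : ℝ → ℝ} (hρ : Continuous ρ) (hρc : HasCompactSupport ρ)
    {G G' : ℝ → ℝ} {K : NNReal} (hG : LipschitzWith K G) (hG' : Measurable G')
    {s : Set ℝ} (hs : s.Finite) (hd : ∀ x ∉ s, HasDerivAt G (G' x) x) (x : ℝ) :
    HasDerivAt (fun x => ∫ t, ρ t * G (x - t)) (∫ t, ρ t * G' (x - t)) x := by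
  refine (hasDerivAt_integral_of_dominated_loc_of_lip (μ := volume) (s := univ)
    (F := fun x t => ρ t * G (x - t)) (F' := fun t => ρ t * G' (x - t))
    (bound := fun t => |ρ t| * K) univ_mem ?_ ?_ ?_ ?_ ?_ ?_).2
  · refine Eventually.of_forall fun y => Continuous.aestronglyMeasurable ?_
    have := hG.continuous
    fun_prop
  · refine Continuous.integrable_of_hasCompactSupport ?_ ?_
    · have := hG.continuous
      fun_prop
    · exact hρc.mul_right
  · refine Measurable.aestronglyMeasurable ?_
    have := hρ.measurable
    fun_prop
  · refine Eventually.of_forall fun t => ?_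
    rw [lipschitzOnWith_univ]
    refine LipschitzWith.of_dist_le_mul fun y z => ?_
    have h1 := hG.dist_le_mul (y - t) (z - t)
    simp only [Real.dist_eq, Real.coe_nnabs] at *
    rw [← mul_sub, abs_mul, abs_mul, abs_abs, mul_assoc, abs_of_nonneg K.coe_nonneg]
    have h2 : y - t - (z - t) = y - z := by ring
    rw [h2] at h1
    exact mul_le_mul_of_nonneg_left h1 (abs_nonneg _)
  · refine Integrable.mul_const ?_ _
    exact (hρ.integrable_of_hasCompactSupport hρc).abs
  · have hfin : ((fun t => x - t) ⁻¹' s).Finite := by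
      refine hs.preimage ?_
      intro a _ b _ hab
      simpa using hab
    have := hfin.countable.ae_notMem volume
    filter_upwards [this] with t ht
    have h1 := (hd (x - t) ht).comp x ((hasDerivAt_id x).sub_const t)
    have h2 := h1.const_mul (ρ t)
    simpa [Function.comp_def] using h2

lemma aux_jensen {ρ f : ℝ → ℝ} (hρ : Continuous ρ) (hρc : HasCompactSupport ρ)
    (hρ0 : ∀ x, 0 ≤ ρ x) (hρ1 : ∫ t, ρ t = 1) (hf : Measurable f) {N : ℝ} (hN : ∀ x, |f x| ≤ N)
    (x : ℝ) :
    (∫ t, ρ t * f (x - t)) ^ 2 ≤ ∫ t, ρ t * (f (x - t)) ^ 2 := by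
  have hi := hρ.integrable_of_hasCompactSupport (μ := volume) hρc
  have i1 : Integrable (fun t => ρ t * f (x - t)) :=
    hi.mul_bdd (c := N) (hf.comp (measurable_const.sub measurable_id)).aestronglyMeasurable (Eventually.of_forall fun t => hN _)
  have i2 : Integrable (fun t => ρ t * (f (x - t)) ^ 2) := by
    refine hi.mul_bdd (c := N ^ 2)
      ((hf.comp (measurable_const.sub measurable_id)).pow_const 2).aestronglyMeasurable (Eventually.of_forall fun t => ?_)
    rw [Real.norm_eq_abs, abs_pow]
    exact pow_le_pow_left₀ (abs_nonneg _) (hN _) 2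
  set m := ∫ t, ρ t * f (x - t) with hm
  have h0 : 0 ≤ ∫ t, ρ t * (f (x - t) - m) ^ 2 :=
    integral_nonneg fun t => mul_nonneg (hρ0 t) (sq_nonneg _)
  have h1 : ∫ t, ρ t * (f (x - t) - m) ^ 2
      = (∫ t, ρ t * (f (x - t)) ^ 2) - 2 * m * m + m ^ 2 * 1 := by
    have e : (fun t => ρ t * (f (x - t) - m) ^ 2) =
        fun t => (ρ t * (f (x - t)) ^ 2 - 2 * m * (ρ t * f (x - t))) + m ^ 2 * ρ t := by
      ext t
      ring
    have i3 : Integrable (fun t => ρ t * (f (x - t)) ^ 2 - 2 * m * (ρ t * f (x - t))) :=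
      i2.sub (i1.const_mul _)
    rw [e, integral_add i3 (hi.const_mul _), integral_sub i2 (i1.const_mul _),
      integral_const_mul, integral_const_mul, hρ1]
  nlinarith

lemma aux_clamp {a : ℝ} (ha : 0 < a) (k : ℕ) (v : ℝ → ℝ)
    (hv : ContDiffOn ℝ k v (Icc (-a) a)) (j : ℕ) (hj : j < k) :
    let G := fun x => iteratedDerivWithin j v (Icc (-a) a)
      (projIcc (-a) a (by linarith) x : ℝ)
    (∃ K : NNReal, LipschitzWith K G) ∧
    (∀ x ∉ ({-a, a} : Set ℝ), HasDerivAt G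
      ((Icc (-a) a).indicator (iteratedDerivWithin (j+1) v (Icc (-a) a)) x) x) := by
  intro G
  have hU : UniqueDiffOn ℝ (Icc (-a) a) := uniqueDiffOn_Icc (by linarith)
  have hdiff := hv.differentiableOn_iteratedDerivWithin (m := j) (by exact_mod_cast hj) hU
  have hcont := hv.continuousOn_iteratedDerivWithin (m := j+1) (by exact_mod_cast hj) hU
  constructor
  · obtain ⟨C, hC⟩ := isCompact_Icc.exists_bound_of_continuousOn hcont
    have hC0 : 0 ≤ C := le_trans (norm_nonneg _) (hC a ⟨by linarith, le_rfl⟩)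
    have hL : LipschitzOnWith ⟨C, hC0⟩ (iteratedDerivWithin j v (Icc (-a) a)) (Icc (-a) a) := by
      refine (convex_Icc _ _).lipschitzOnWith_of_nnnorm_derivWithin_le hdiff ?_
      intro x hx
      rw [← iteratedDerivWithin_succ]
      exact hC x hx
    have hL2 := hL.to_restrict.comp (LipschitzWith.projIcc (a := -a) (b := a) (by linarith))
    exact ⟨_, hL2⟩
  · intro x hx
    simp only [mem_insert_iff, mem_singleton_iff, not_or] at hx
    rcases lt_or_gt_of_ne hx.1 with h1 | h1
    · have : G =ᶠ[nhds x] fun _ => iteratedDerivWithin j v (Icc (-a) a) (-a) := by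
        filter_upwards [Iio_mem_nhds h1] with y hy
        simp only [G]
        rw [projIcc_of_le_left _ (le_of_lt hy)]
      rw [indicator_of_notMem (by simp; intro; linarith)]
      exact (hasDerivAt_const x _).congr_of_eventuallyEq this
    · rcases lt_or_gt_of_ne hx.2 with h2 | h2
      · have hm : Icc (-a) a ∈ nhds x := Icc_mem_nhds h1 h2
        have : G =ᶠ[nhds x] iteratedDerivWithin j v (Icc (-a) a) := by
          filter_upwards [hm] with y hy
          simp only [G]
          rw [projIcc_of_mem _ hy]
        have hxI : x ∈ Icc (-a) a := ⟨h1.le, h2.le⟩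
        rw [indicator_of_mem hxI, iteratedDerivWithin_succ]
        exact ((hdiff x hxI).hasDerivWithinAt.hasDerivAt hm).congr_of_eventuallyEq this
      · have : G =ᶠ[nhds x] fun _ => iteratedDerivWithin j v (Icc (-a) a) a := by
          filter_upwards [Ioi_mem_nhds h2] with y hy
          simp only [G]
          rw [projIcc_of_right_le _ (le_of_lt hy)]
        rw [indicator_of_notMem (by simp; intro; linarith)]
        exact (hasDerivAt_const x _).congr_of_eventuallyEq this

lemma aux_profile (k : ℕ) (hk : 1 ≤ k) (E : ℝ) (hE : E ∈ mkSet k) (η : ℝ) (hη : 0 < η) :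
    ∃ S : ℝ, 0 < S ∧ ∃ w : ℝ → ℝ, ContDiff ℝ (⊤ : ℕ∞) w ∧ (∀ x ≤ -S, w x = -(1/2)) ∧
      (∀ x ≥ S, w x = 1/2) ∧ Integrable (fun x => (iteratedDeriv k w x) ^ 2) ∧
      (∃ N, ∀ x, |iteratedDeriv k w x| ≤ N) ∧
      2 * S + ∫ x, (iteratedDeriv k w x) ^ 2 ≤ E + 2 * η := by
  obtain ⟨T, hT, v, hv, hvl, hvr, hvd, rfl⟩ := hE
  obtain ⟨a, rfl⟩ : ∃ a, T = 2 * a := ⟨T / 2, by ring⟩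
  rw [show 2 * a / 2 = a by ring] at *
  have ha : 0 < a := by linarith
  have hU : UniqueDiffOn ℝ (Icc (-a) a) := uniqueDiffOn_Icc (by linarith)
  let φ : ContDiffBump (0:ℝ) := ⟨η / 2, η, by linarith, by linarith⟩
  set ρ : ℝ → ℝ := φ.normed volume with hρdef
  have hρs : ContDiff ℝ (⊤ : ℕ∞) ρ := φ.contDiff_normed
  have hρ : Continuous ρ := hρs.continuous
  have hρc : HasCompactSupport ρ := φ.hasCompactSupport_normed
  have hρ0 : ∀ x, 0 ≤ ρ x := fun x => φ.nonneg_normed x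
  have hρ1 : ∫ t, ρ t = 1 := φ.integral_normed
  let G : ℕ → ℝ → ℝ := fun j x => iteratedDerivWithin j v (Icc (-a) a)
      (projIcc (-a) a (by linarith) x : ℝ)
  let P : ℕ → ℝ → ℝ := fun j => (Icc (-a) a).indicator (iteratedDerivWithin j v (Icc (-a) a))
  have hPm : ∀ j ≤ k, Measurable (P j) := by
    intro j hj
    have hcont := hv.continuousOn_iteratedDerivWithin (m := j) (by exact_mod_cast hj) hU
    classical
    have := hcont.measurable_piecewise (g := 0) continuousOn_const measurableSet_Icc
    rwa [piecewise_eq_indicator] at this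
  have hPG : ∀ j, 1 ≤ j → j < k → P j = G j := by
    intro j h1 h2
    have := hvd j h1 (by omega)
    ext x
    simp only [P, G]
    by_cases hx : x ∈ Icc (-a) a
    · rw [indicator_of_mem hx, projIcc_of_mem _ hx]
    · rw [indicator_of_notMem hx]
      rcases lt_or_ge x (-a) with h | h
      · rw [projIcc_of_le_left _ h.le]
        exact this.1.symm
      · rw [projIcc_of_right_le _ (by by_contra h'; exact hx ⟨h, (not_le.1 h').le⟩)]
        exact this.2.symm
  let w : ℝ → ℝ := fun x => ∫ t, ρ t * G 0 (x - t)
  have hwconv : w = convolution ρ (G 0) (ContinuousLinearMap.lsmul ℝ ℝ) volume := by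
    ext x
    simp [w, convolution]
  obtain ⟨⟨K, hK⟩, -⟩ := aux_clamp ha k v hv 0 (by omega)
  have hG0 : Continuous (G 0) := hK.continuous
  have hstep : ∀ j < k, ∀ x, HasDerivAt (fun x => ∫ t, ρ t * G j (x - t))
      (∫ t, ρ t * P (j+1) (x - t)) x := by
    intro j hj x
    obtain ⟨⟨K, hK⟩, hd⟩ := aux_clamp ha k v hv j hj
    exact aux_conv_deriv hρ hρc hK (hPm (j+1) hj) (Set.toFinite _) hd x
  have hit : ∀ j < k, iteratedDeriv j w = fun x => ∫ t, ρ t * G j (x - t) := by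
    intro j
    induction j with
    | zero => intro _; ext x; simp [w]
    | succ j ih =>
      intro hj
      rw [iteratedDeriv_succ, ih (by omega)]
      ext x
      rw [(hstep j (by omega) x).deriv, hPG (j+1) (by omega) hj]
  have hitk : iteratedDeriv k w = fun x => ∫ t, ρ t * P k (x - t) := by
    obtain ⟨m, rfl⟩ : ∃ m, k = m + 1 := ⟨k - 1, by omega⟩
    rw [iteratedDeriv_succ, hit m (by omega)]
    ext x
    rw [(hstep m (by omega) x).deriv]
  have hcontk := hv.continuousOn_iteratedDerivWithin (m := k) le_rfl hU
  obtain ⟨N, hN⟩ := isCompact_Icc.exists_bound_of_continuousOn hcontk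
  have hN0 : 0 ≤ N := le_trans (norm_nonneg _) (hN a ⟨by linarith, le_rfl⟩)
  have hPN : ∀ x, |P k x| ≤ N := by
    intro x
    simp only [P]
    by_cases hx : x ∈ Icc (-a) a
    · rw [indicator_of_mem hx]; exact hN x hx
    · rw [indicator_of_notMem hx]; simpa using hN0
  have hP2 : (fun x => P k x ^ 2) =
      (Icc (-a) a).indicator (fun x => (iteratedDerivWithin k v (Icc (-a) a) x) ^ 2) := by
    ext x
    simp only [P]
    by_cases hx : x ∈ Icc (-a) a
    · rw [indicator_of_mem hx, indicator_of_mem hx]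
    · rw [indicator_of_notMem hx, indicator_of_notMem hx]; simp
  have hP2i : Integrable (fun x => P k x ^ 2) := by
    rw [hP2, integrable_indicator_iff measurableSet_Icc]
    exact (hcontk.pow 2).integrableOn_compact isCompact_Icc
  have hρi := hρ.integrable_of_hasCompactSupport (μ := volume) hρc
  have hconv2 : (fun x => ∫ t, ρ t * (P k (x - t)) ^ 2) =
      convolution ρ (fun x => P k x ^ 2) (ContinuousLinearMap.lsmul ℝ ℝ) volume := by
    ext x
    simp [convolution]
  have hc2i : Integrable (fun x => ∫ t, ρ t * (P k (x - t)) ^ 2) := by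
    rw [hconv2]
    exact hρi.integrable_convolution _ hP2i
  have hc2 : ∫ x, ∫ t, ρ t * (P k (x - t)) ^ 2 = ∫ x, P k x ^ 2 := by
    rw [hconv2, integral_convolution _ hρi hP2i, hρ1]
    simp
  have hws : ContDiff ℝ (⊤ : ℕ∞) w := by
    rw [hwconv]
    exact hρc.contDiff_convolution_left _ hρs hG0.locallyIntegrable
  have hwkc : Continuous (iteratedDeriv k w) :=
    hws.continuous_iteratedDeriv k (by exact_mod_cast le_top)
  have hle : ∀ x, (iteratedDeriv k w x) ^ 2 ≤ ∫ t, ρ t * (P k (x - t)) ^ 2 := by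
    intro x
    rw [hitk]
    exact aux_jensen hρ hρc hρ0 hρ1 (hPm k le_rfl) hPN x
  refine ⟨a + η, by linarith, w, hws, ?_, ?_, ?_, ?_, ?_⟩
  · intro x hx
    have h1 : ∀ y ∈ Metric.ball x η, G 0 y = -(1/2) := by
      intro y hy
      rw [Metric.mem_ball, Real.dist_eq, abs_lt] at hy
      simp only [G]
      rw [projIcc_of_le_left _ (by linarith)]
      simpa using hvl
    rw [hwconv, ContDiffBump.normed_convolution_eq_right]
    · exact h1 x (Metric.mem_ball_self hη)
    · intro y hy
      rw [h1 x (Metric.mem_ball_self hη), h1 y hy]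
  · intro x hx
    have h1 : ∀ y ∈ Metric.ball x η, G 0 y = 1/2 := by
      intro y hy
      rw [Metric.mem_ball, Real.dist_eq, abs_lt] at hy
      simp only [G]
      rw [projIcc_of_right_le _ (by linarith)]
      simpa using hvr
    rw [hwconv, ContDiffBump.normed_convolution_eq_right]
    · exact h1 x (Metric.mem_ball_self hη)
    · intro y hy
      rw [h1 x (Metric.mem_ball_self hη), h1 y hy]
  · refine hc2i.mono' (by fun_prop) (Eventually.of_forall fun x => ?_)
    rw [Real.norm_eq_abs, abs_of_nonneg (sq_nonneg _)]
    exact hle x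
  · refine ⟨N, fun x => ?_⟩
    rw [hitk]
    calc |∫ t, ρ t * P k (x - t)| ≤ ∫ t, |ρ t * P k (x - t)| := abs_integral_le_integral_abs
      _ ≤ ∫ t, ρ t * N := by
        refine integral_mono_of_nonneg (Eventually.of_forall fun t => abs_nonneg _)
          (hρi.mul_const N) (Eventually.of_forall fun t => ?_)
        simp only [abs_mul, abs_of_nonneg (hρ0 t)]
        exact mul_le_mul_of_nonneg_left (hPN _) (hρ0 t)
      _ = N := by rw [integral_mul_const, hρ1, one_mul]
  · have h1 : ∫ x, (iteratedDeriv k w x) ^ 2 ≤ ∫ x, P k x ^ 2 := by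
      rw [← hc2]
      exact integral_mono_of_nonneg (Eventually.of_forall fun x => sq_nonneg _) hc2i
        (Eventually.of_forall hle)
    rw [hP2, integral_indicator measurableSet_Icc] at h1
    linarith

lemma aux_nonempty (k : ℕ) : (mkSet k).Nonempty := by
  refine ⟨_, 4, by norm_num, fun t => Real.smoothTransition t - 1/2, ?_, ?_, ?_, ?_, rfl⟩
  · exact (Real.smoothTransition.contDiff.sub contDiff_const).contDiffOn
  · show Real.smoothTransition (-(4/2)) - 1/2 = -(1/2)
    rw [Real.smoothTransition.zero_of_nonpos (by norm_num)]; norm_num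
  · show Real.smoothTransition (4/2) - 1/2 = 1/2
    rw [Real.smoothTransition.one_of_one_le (by norm_num)]; norm_num
  · intro l hl _
    have hc : ContDiff ℝ l (fun t => Real.smoothTransition t - 1/2) :=
      Real.smoothTransition.contDiff.sub contDiff_const
    have hU : UniqueDiffOn ℝ (Icc (-((4:ℝ)/2)) (4/2)) := uniqueDiffOn_Icc (by norm_num)
    constructor
    · rw [iteratedDerivWithin_eq_iteratedDeriv hU hc.contDiffAt (by norm_num)]
      have : (fun t => Real.smoothTransition t - 1/2) =ᶠ[nhds (-((4:ℝ)/2))] fun _ => -(1/2) := by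
        filter_upwards [Iio_mem_nhds (show (-((4:ℝ)/2)) < 0 by norm_num)] with y hy
        rw [Real.smoothTransition.zero_of_nonpos (le_of_lt hy)]; norm_num
      rw [this.iteratedDeriv_eq, iteratedDeriv_const]
      simp; omega
    · rw [iteratedDerivWithin_eq_iteratedDeriv hU hc.contDiffAt (by norm_num)]
      have : (fun t => Real.smoothTransition t - 1/2) =ᶠ[nhds ((4:ℝ)/2)] fun _ => 1/2 := by
        filter_upwards [Ioi_mem_nhds (show (1:ℝ) < 4/2 by norm_num)] with y hy
        rw [Real.smoothTransition.one_of_one_le (le_of_lt hy)]; norm_num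
      rw [this.iteratedDeriv_eq, iteratedDeriv_const]
      simp; omega

lemma aux_glue (t₀ : ℝ) (n : ℕ) : ∀ (a b : ℝ → ℝ), ContDiff ℝ (⊤ : ℕ∞) a → ContDiff ℝ (⊤ : ℕ∞) b →
    (∀ l, iteratedDeriv l a t₀ = iteratedDeriv l b t₀) →
    ContDiff ℝ n (fun t => if t ≤ t₀ then a t else b t) := by
  induction n with
  | zero =>
    intro a b ha hb hl
    rw [Nat.cast_zero, contDiff_zero]
    refine Continuous.if_le ha.continuous hb.continuous continuous_id continuous_const ?_
    rintro x rfl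
    simpa using hl 0
  | succ n ih =>
    intro a b ha hb hl
    have ha' := contDiff_infty_iff_deriv.1 ha
    have hb' := contDiff_infty_iff_deriv.1 hb
    have h0 : a t₀ = b t₀ := by simpa using hl 0
    have h1 : deriv a t₀ = deriv b t₀ := by simpa using hl 1
    have hd : ∀ x, HasDerivAt (fun t => if t ≤ t₀ then a t else b t)
        (if x ≤ t₀ then deriv a x else deriv b x) x := by
      intro x
      have hax := (ha'.1 x).hasDerivAt
      have hbx := (hb'.1 x).hasDerivAt
      rcases lt_trichotomy x t₀ with h | h | h
      · rw [if_pos h.le]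
        refine hax.congr_of_eventuallyEq ?_
        filter_upwards [Iio_mem_nhds h] with y hy
        rw [if_pos (le_of_lt hy)]
      · subst h
        rw [if_pos le_rfl]
        rw [← hasDerivWithinAt_univ, ← Iic_union_Ici (a := x)]
        refine HasDerivWithinAt.union ?_ ?_
        · refine hax.hasDerivWithinAt.congr (fun y hy => if_pos hy) (by simp)
        · rw [h1]
          refine hbx.hasDerivWithinAt.congr (fun y hy => ?_) (by simp [h0])
          rcases eq_or_lt_of_le (show x ≤ y from hy) with rfl | h
          · simp [h0]
          · rw [if_neg (not_le.2 h)]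
      · rw [if_neg (not_le.2 h)]
        refine hbx.congr_of_eventuallyEq ?_
        filter_upwards [Ioi_mem_nhds h] with y hy
        rw [if_neg (not_le.2 hy)]
    rw [Nat.cast_succ, contDiff_succ_iff_deriv]
    refine ⟨fun x => (hd x).differentiableAt, by simp, ?_⟩
    have : deriv (fun t => if t ≤ t₀ then a t else b t) =
        fun t => if t ≤ t₀ then deriv a t else deriv b t := by
      ext x; exact (hd x).deriv
    rw [this]
    refine ih _ _ ha'.2 hb'.2 fun l => ?_
    have := hl (l+1)
    rwa [iteratedDeriv_succ', iteratedDeriv_succ'] at this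

lemma aux_ind (f p : ℝ → ℝ) (t₀ C r : ℝ) (hf : ∀ t, 0 ≤ f t)
    (hp : IntegrableOn p (Ioo 0 1)) (hC : 0 ≤ C) (hr : 0 ≤ r)
    (h : ∀ t ∈ Ioo (0:ℝ) 1, t ≠ t₀ →
      f t ≤ p t + (Icc (t₀ - r) (t₀ + r)).indicator (fun _ => C) t) :
    ∫ t in Ioo (0:ℝ) 1, f t ≤ (∫ t in Ioo (0:ℝ) 1, p t) + C * (2 * r) := by
  have hi : Integrable ((Icc (t₀ - r) (t₀ + r)).indicator (fun _ => C)) := by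
    rw [integrable_indicator_iff measurableSet_Icc]
    exact integrableOn_const (by simp)
  have hae : ∀ᵐ t : ℝ, t ≠ t₀ := by
    have := (Set.countable_singleton t₀).ae_notMem volume
    simpa using this
  calc ∫ t in Ioo (0:ℝ) 1, f t
      ≤ ∫ t in Ioo (0:ℝ) 1, (p t + (Icc (t₀ - r) (t₀ + r)).indicator (fun _ => C) t) := by
        refine integral_mono_of_nonneg (Eventually.of_forall hf) (hp.add hi.integrableOn) ?_
        filter_upwards [ae_restrict_mem measurableSet_Ioo, ae_restrict_of_ae hae] with t h1 h2
        exact h t h1 h2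
    _ = (∫ t in Ioo (0:ℝ) 1, p t) +
        ∫ t in Ioo (0:ℝ) 1, (Icc (t₀ - r) (t₀ + r)).indicator (fun _ => C) t :=
        integral_add hp hi.integrableOn
    _ ≤ (∫ t in Ioo (0:ℝ) 1, p t) + ∫ t, (Icc (t₀ - r) (t₀ + r)).indicator (fun _ => C) t := by
        refine add_le_add_right ?_ _
        refine setIntegral_le_integral hi (Eventually.of_forall fun t => ?_)
        exact indicator_nonneg (fun _ _ => hC) t
    _ = _ := by
        rw [integral_indicator measurableSet_Icc, setIntegral_const, Real.volume_real_Icc,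
          smul_eq_mul, max_eq_left (by linarith)]
        ring

lemma aux_sq (a b : ℝ → ℝ) (M N : ℝ) (ha : ∀ t ∈ Ioo (0:ℝ) 1, |a t| ≤ M) (hb : ∀ t, |b t| ≤ N)
    (hbi : Integrable (fun t => b t ^ 2)) :
    ∫ t in Ioo (0:ℝ) 1, (a t + b t) ^ 2 ≤ (M ^ 2 + 2 * M * N) + ∫ t, b t ^ 2 := by
  calc ∫ t in Ioo (0:ℝ) 1, (a t + b t) ^ 2
      ≤ ∫ t in Ioo (0:ℝ) 1, ((M ^ 2 + 2 * M * N) + b t ^ 2) := by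
        refine integral_mono_of_nonneg (Eventually.of_forall fun t => sq_nonneg _)
          ((integrableOn_const (by simp)).add hbi.integrableOn) ?_
        filter_upwards [ae_restrict_mem measurableSet_Ioo] with t ht
        have h1 := ha t ht
        have h2 := hb t
        have h3 : a t * b t ≤ M * N := by
          calc a t * b t ≤ |a t * b t| := le_abs_self _
            _ = |a t| * |b t| := abs_mul _ _
            _ ≤ M * N := mul_le_mul h1 h2 (abs_nonneg _) ((abs_nonneg _).trans h1)
        have h4 : a t ^ 2 ≤ M ^ 2 := by
          rw [← sq_abs]
          exact pow_le_pow_left₀ (abs_nonneg _) h1 2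
        nlinarith
    _ = (M ^ 2 + 2 * M * N) + ∫ t in Ioo (0:ℝ) 1, b t ^ 2 := by
        have hci : Integrable (fun _ : ℝ => M ^ 2 + 2 * M * N) (volume.restrict (Ioo 0 1)) :=
          integrableOn_const (by simp)
        rw [integral_add hci hbi.integrableOn, setIntegral_const]
        simp
    _ ≤ _ := by
        refine add_le_add_right ?_ _
        exact setIntegral_le_integral hbi (Eventually.of_forall fun t => sq_nonneg _)

/-- upper bound construction of Proposition 5.6 of the paper, for a single
jump: if `u` coincides on `(0,t₀)` and `(t₀,1)` with smooth functions `g`, `h` having a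
jump `h(t₀) ≠ g(t₀)` and all derivatives vanishing at `t₀`, then for every `δ > 0` there is
a family `(u_ε)` of functions smooth on `(0,1)` converging to `u` in `L¹(0,1)` with
`limsup_{ε→0} F_ε(u_ε) ≤ m_k |u(t₀+) - u(t₀-)|^{1/k} + ∫_0^1 (u')² + δ`. -/
theorem upper_bound_single_jump (k : ℕ) (hk : 2 ≤ k) (t₀ : ℝ) (ht₀ : t₀ ∈ Ioo (0:ℝ) 1)
    (u g h : ℝ → ℝ)
    (hg : ContDiff ℝ (⊤ : ℕ∞) g) (hh : ContDiff ℝ (⊤ : ℕ∞) h)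
    (hug : ∀ t ∈ Ioo 0 t₀, u t = g t) (huh : ∀ t ∈ Ioo t₀ 1, u t = h t)
    (hjump : g t₀ ≠ h t₀)
    (hder : ∀ ℓ : ℕ, 1 ≤ ℓ → iteratedDeriv ℓ g t₀ = 0 ∧ iteratedDeriv ℓ h t₀ = 0) :
    ∀ δ : ℝ, 0 < δ →
      ∃ w : ℝ → ℝ → ℝ,
        (∀ ε ∈ Ioo (0:ℝ) 1, ContDiffOn ℝ (⊤ : ℕ∞) (w ε) (Ioo (0:ℝ) 1)) ∧
        Tendsto (fun ε : ℝ => ∫ t in Ioo (0:ℝ) 1, |w ε t - u t|)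
          (nhdsWithin 0 (Ioo (0:ℝ) 1)) (nhds 0) ∧
        Filter.limsup (fun ε : ℝ => Fe k ε (w ε)) (nhdsWithin 0 (Ioo (0:ℝ) 1)) ≤
          sInf (mkSet k) * |h t₀ - g t₀| ^ ((1:ℝ) / k) +
            (∫ t in Ioo (0:ℝ) 1, (deriv u t) ^ 2) + δ := by
  intro δ hδ
  set z := h t₀ - g t₀ with hz
  have hz0 : z ≠ 0 := sub_ne_zero.2 hjump.symm
  set lam := |z| ^ ((1:ℝ) / k) with hlam
  have hlam0 : 0 < lam := Real.rpow_pos_of_pos (abs_pos.2 hz0) _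
  have hlamk : lam ^ k = |z| := by
    rw [hlam, one_div]
    exact Real.rpow_inv_natCast_pow (abs_nonneg _) (by omega)
  set η := δ / (6 * lam) with hη
  have hη0 : 0 < η := by positivity
  obtain ⟨E, hE, hElt⟩ := Real.lt_sInf_add_pos (aux_nonempty k) hη0
  obtain ⟨S, hS, w, hw, hwl, hwr, hwi, ⟨N, hN⟩, hwE⟩ := aux_profile k (by omega) E hE η hη0
  set Wk := ∫ x, (iteratedDeriv k w x) ^ 2 with hWk
  obtain ⟨B, hB⟩ : ∃ B, ∀ x, |w x| ≤ B := by
    obtain ⟨B, hB⟩ := (isCompact_Icc (a := -S) (b := S)).exists_bound_of_continuousOn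
      hw.continuous.continuousOn
    have h1 := hB S ⟨by linarith, le_rfl⟩
    rw [hwr S le_rfl] at h1
    have h1' : (1/2 : ℝ) ≤ B := le_trans (le_abs_self _) h1
    refine ⟨B, fun x => ?_⟩
    rcases le_total x (-S) with h | h
    · rw [hwl x h, abs_neg, abs_of_nonneg (by norm_num)]; exact h1'
    · rcases le_total x S with h2 | h2
      · exact hB x ⟨h, h2⟩
      · rw [hwr x h2, abs_of_nonneg (by norm_num)]; exact h1'
  let U : ℝ → ℝ := fun t => if t ≤ t₀ then g t - g t₀ else h t - h t₀
  have hU : ContDiff ℝ (⊤ : ℕ∞) U := by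
    rw [contDiff_infty]
    intro n
    refine aux_glue t₀ n _ _ (hg.sub contDiff_const) (hh.sub contDiff_const) fun l => ?_
    rcases Nat.eq_zero_or_pos l with rfl | hl
    · simp
    · have e1 : iteratedDeriv l (fun t => g t - g t₀) t₀ = iteratedDeriv l g t₀ := by
        have := iteratedDeriv_const_add (x := t₀) (f := g) hl (-(g t₀))
        rw [← this]; congr 1; ext t; ring
      have e2 : iteratedDeriv l (fun t => h t - h t₀) t₀ = iteratedDeriv l h t₀ := by
        have := iteratedDeriv_const_add (x := t₀) (f := h) hl (-(h t₀))
        rw [← this]; congr 1; ext t; ring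
      rw [e1, e2, (hder l hl).1, (hder l hl).2]
  have hUl : ∀ t ∈ Ioo 0 t₀, u t = U t + g t₀ := by
    intro t ht
    rw [hug t ht]
    simp only [U]
    rw [if_pos ht.2.le]; ring
  have hUr : ∀ t ∈ Ioo t₀ 1, u t = U t + h t₀ := by
    intro t ht
    rw [huh t ht]
    simp only [U]
    rw [if_neg (not_le.2 ht.1)]; ring
  have hdu : ∀ t ∈ Ioo (0:ℝ) 1, t ≠ t₀ → deriv u t = deriv U t := by
    intro t ht hne
    rcases lt_or_gt_of_ne hne with h1 | h1
    · have : u =ᶠ[nhds t] fun t => U t + g t₀ := by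
        filter_upwards [Ioo_mem_nhds ht.1 h1] with y hy using hUl y hy
      rw [this.deriv_eq, deriv_add_const]
    · have : u =ᶠ[nhds t] fun t => U t + h t₀ := by
        filter_upwards [Ioo_mem_nhds h1 ht.2] with y hy using hUr y hy
      rw [this.deriv_eq, deriv_add_const]
  have hUi : IntegrableOn (fun t => (deriv U t) ^ 2) (Ioo 0 1) := by
    have : Continuous (deriv U) := hU.continuous_deriv (by exact_mod_cast le_top)
    exact ((this.pow 2).integrableOn_Icc (a := 0) (b := 1)).mono_set Ioo_subset_Icc_self
  have hint : ∫ t in Ioo (0:ℝ) 1, (deriv u t) ^ 2 = ∫ t in Ioo (0:ℝ) 1, (deriv U t) ^ 2 := by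
    have hae : ∀ᵐ t : ℝ, t ≠ t₀ := by
      have := (Set.countable_singleton t₀).ae_notMem volume
      simpa using this
    refine integral_congr_ae ?_
    filter_upwards [ae_restrict_mem measurableSet_Ioo, ae_restrict_of_ae hae] with t h1 h2
    rw [hdu t h1 h2]
  obtain ⟨M, hM⟩ : ∃ M, ∀ t ∈ Ioo (0:ℝ) 1, |iteratedDeriv k U t| ≤ M := by
    have : Continuous (iteratedDeriv k U) :=
      hU.continuous_iteratedDeriv k (by exact_mod_cast le_top)
    obtain ⟨M, hM⟩ := (isCompact_Icc (a := (0:ℝ)) (b := 1)).exists_bound_of_continuousOn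
      this.continuousOn
    exact ⟨M, fun t ht => hM t (Ioo_subset_Icc_self ht)⟩
  let c := (g t₀ + h t₀) / 2
  let W : ℝ → ℝ → ℝ := fun ε t => U t + (c + z * w ((ε * lam)⁻¹ * (t - t₀)))
  have hWs : ∀ ε, ContDiff ℝ (⊤ : ℕ∞) (W ε) := by
    intro ε
    refine hU.add (contDiff_const.add (contDiff_const.mul (hw.comp ?_)))
    exact contDiff_const.mul (contDiff_id.sub contDiff_const)
  have hWl : ∀ ε, 0 < ε → ∀ t, t ≤ t₀ - ε * (lam * S) → W ε t = U t + g t₀ := by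
    intro ε hε t ht
    have : (ε * lam)⁻¹ * (t - t₀) ≤ -S := by
      rw [inv_mul_le_iff₀ (by positivity)]
      linarith
    simp only [W]
    rw [hwl _ this]
    simp only [c, hz]
    ring
  have hWr : ∀ ε, 0 < ε → ∀ t, t₀ + ε * (lam * S) ≤ t → W ε t = U t + h t₀ := by
    intro ε hε t ht
    have : S ≤ (ε * lam)⁻¹ * (t - t₀) := by
      rw [le_inv_mul_iff₀ (by positivity)]
      linarith
    simp only [W]
    rw [hwr _ this]
    simp only [c, hz]
    ring
  have hdW : ∀ ε, 0 < ε → ∀ t, t ∉ Icc (t₀ - ε * (lam * S)) (t₀ + ε * (lam * S)) →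
      deriv (W ε) t = deriv U t := by
    intro ε hε t ht
    rcases lt_or_ge t (t₀ - ε * (lam * S)) with h1 | h1
    · have : W ε =ᶠ[nhds t] fun t => U t + g t₀ := by
        filter_upwards [Iio_mem_nhds h1] with y hy using hWl ε hε y (le_of_lt hy)
      rw [this.deriv_eq, deriv_add_const]
    · have h2 : t₀ + ε * (lam * S) < t := by
        by_contra h'
        exact ht ⟨h1, not_lt.1 h'⟩
      have : W ε =ᶠ[nhds t] fun t => U t + h t₀ := by
        filter_upwards [Ioi_mem_nhds h2] with y hy using hWr ε hε y (le_of_lt hy)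
      rw [this.deriv_eq, deriv_add_const]
  have hitW : ∀ ε t, iteratedDeriv k (W ε) t = iteratedDeriv k U t +
      z * ((ε * lam)⁻¹ ^ k * iteratedDeriv k w ((ε * lam)⁻¹ * (t - t₀))) := by
    intro ε t
    have hkt : ((k : ℕ) : WithTop ℕ∞) ≤ ((⊤ : ℕ∞) : WithTop ℕ∞) := by exact_mod_cast le_top
    have hwk : ContDiff ℝ k w := hw.of_le hkt
    have hUk : ContDiff ℝ k U := hU.of_le hkt
    have s1 : ContDiff ℝ k (fun x => w ((ε * lam)⁻¹ * (x - t₀))) :=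
      hwk.comp (contDiff_const.mul (contDiff_id.sub contDiff_const))
    have e1 : iteratedDeriv k (fun x => w ((ε * lam)⁻¹ * (x - t₀))) t =
        (ε * lam)⁻¹ ^ k * iteratedDeriv k w ((ε * lam)⁻¹ * (t - t₀)) := by
      have := iteratedDeriv_comp_sub_const k (fun x => w ((ε * lam)⁻¹ * x)) t₀
      rw [this, iteratedDeriv_comp_const_mul hwk]
    simp only [W]
    rw [iteratedDeriv_fun_add hUk.contDiffAt
      (contDiff_const.add (contDiff_const.mul s1)).contDiffAt,
      iteratedDeriv_const_add (by omega), iteratedDeriv_const_mul _ s1.contDiffAt, e1]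
  have hmem : ∀ᶠ ε : ℝ in nhdsWithin 0 (Ioo (0:ℝ) 1), ε ∈ Ioo (0:ℝ) 1 := self_mem_nhdsWithin
  have hB0 : 0 ≤ B := (abs_nonneg _).trans (hB 0)
  refine ⟨W, fun ε _ => (hWs ε).contDiffOn, ?_, ?_⟩
  · have hup : Tendsto (fun ε : ℝ => |z| * (B + 1/2) * (2 * (ε * (lam * S))))
        (nhdsWithin 0 (Ioo (0:ℝ) 1)) (nhds 0) := by
      have : Continuous (fun ε : ℝ => |z| * (B + 1/2) * (2 * (ε * (lam * S)))) := by fun_prop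
      have h0 := this.tendsto 0
      simp only [zero_mul, mul_zero] at h0
      exact h0.mono_left nhdsWithin_le_nhds
    refine tendsto_of_tendsto_of_tendsto_of_le_of_le' tendsto_const_nhds hup
      (Eventually.of_forall fun ε => integral_nonneg fun t => abs_nonneg _) ?_
    filter_upwards [hmem] with ε hε
    have hε0 := hε.1
    have := aux_ind (fun t => |W ε t - u t|) (fun _ => 0) t₀ (|z| * (B + 1/2)) (ε * (lam * S))
      (fun t => abs_nonneg _) integrableOn_zero (by positivity) (by positivity) ?_
    · simpa using this
    intro t ht hne
    rw [zero_add]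
    by_cases hI : t ∈ Icc (t₀ - ε * (lam * S)) (t₀ + ε * (lam * S))
    · rw [indicator_of_mem hI]
      have hb := abs_le.1 (hB ((ε * lam)⁻¹ * (t - t₀)))
      rcases lt_or_gt_of_ne hne with h1 | h1
      · have e : W ε t - u t = z * (w ((ε * lam)⁻¹ * (t - t₀)) + 1/2) := by
          rw [hUl t ⟨ht.1, h1⟩]
          simp only [W, c, hz]
          ring
        rw [e, abs_mul]
        gcongr
        rw [abs_le]; constructor <;> linarith
      · have e : W ε t - u t = z * (w ((ε * lam)⁻¹ * (t - t₀)) - 1/2) := by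
          rw [hUr t ⟨h1, ht.2⟩]
          simp only [W, c, hz]
          ring
        rw [e, abs_mul]
        gcongr
        rw [abs_le]; constructor <;> linarith
    · rw [indicator_of_notMem hI]
      have hpos : 0 < ε * (lam * S) := by positivity
      rcases lt_or_ge t (t₀ - ε * (lam * S)) with h1 | h1
      · rw [hWl ε hε0 t h1.le, hUl t ⟨ht.1, by linarith⟩]; simp
      · have h2 : t₀ + ε * (lam * S) < t := by
          by_contra h'
          exact hI ⟨h1, not_lt.1 h'⟩
        rw [hWr ε hε0 t h2.le, hUr t ⟨by linarith, ht.2⟩]; simp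
  · have hne : (nhdsWithin (0:ℝ) (Ioo (0:ℝ) 1)).NeBot :=
      left_nhdsWithin_Ioo_neBot one_pos
    have hsmall : ∀ᶠ ε : ℝ in nhdsWithin 0 (Ioo (0:ℝ) 1),
        ε ^ (2 * k - 1) * M ^ 2 + 2 * M * N * ε ^ (k - 1) < δ / 2 := by
      have : Continuous (fun ε : ℝ => ε ^ (2 * k - 1) * M ^ 2 + 2 * M * N * ε ^ (k - 1)) := by
        fun_prop
      have h0 := this.tendsto 0
      simp only [zero_pow (show 2 * k - 1 ≠ 0 by omega), zero_pow (show k - 1 ≠ 0 by omega),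
        zero_mul, mul_zero, add_zero] at h0
      exact (h0.mono_left nhdsWithin_le_nhds).eventually_lt_const (by linarith)
    refine limsup_le_of_le ?_ ?_
    · refine IsBoundedUnder.isCoboundedUnder_le ?_
      refine ⟨0, ?_⟩
      rw [eventually_map]
      filter_upwards [hmem] with ε hε
      have hε0 := hε.1
      unfold Fe
      refine add_nonneg (integral_nonneg fun t => le_min (sq_nonneg _) (by positivity))
        (mul_nonneg (by positivity) (integral_nonneg fun t => sq_nonneg _))
    · filter_upwards [hmem, hsmall] with ε hε hsm
      have hε0 := hε.1
      have hF1 : ∫ t in Ioo (0:ℝ) 1, min ((deriv (W ε) t) ^ 2) (1 / ε) ≤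
          (∫ t in Ioo (0:ℝ) 1, (deriv U t) ^ 2) + 2 * lam * S := by
        have := aux_ind (fun t => min ((deriv (W ε) t) ^ 2) (1 / ε)) (fun t => (deriv U t) ^ 2)
          t₀ (1 / ε) (ε * (lam * S)) (fun t => le_min (sq_nonneg _) (by positivity)) hUi
          (by positivity) (by positivity) ?_
        · refine this.trans (le_of_eq ?_)
          field_simp
        intro t ht _
        by_cases hI : t ∈ Icc (t₀ - ε * (lam * S)) (t₀ + ε * (lam * S))
        · rw [indicator_of_mem hI]
          have := min_le_right ((deriv (W ε) t) ^ 2) (1 / ε)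
          have := sq_nonneg (deriv U t)
          linarith
        · rw [indicator_of_notMem hI, hdW ε hε0 t hI, add_zero]
          exact min_le_left _ _
      have hq : |z * (ε * lam)⁻¹ ^ k| = (ε ^ k)⁻¹ := by
        rw [abs_mul, abs_of_pos (show 0 < (ε * lam)⁻¹ ^ k by positivity), ← hlamk, inv_pow,
          mul_pow]
        field_simp
      let b : ℝ → ℝ := fun t =>
        z * ((ε * lam)⁻¹ ^ k * iteratedDeriv k w ((ε * lam)⁻¹ * (t - t₀)))
      have hbb : ∀ t, |b t| ≤ (ε ^ k)⁻¹ * N := by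
        intro t
        simp only [b]
        rw [← mul_assoc, abs_mul, hq]
        have := hN ((ε * lam)⁻¹ * (t - t₀))
        gcongr
      have hb2 : (fun t => b t ^ 2) = fun t => ((ε ^ k)⁻¹) ^ 2 *
          (fun y => (iteratedDeriv k w y) ^ 2) ((ε * lam)⁻¹ * (t - t₀)) := by
        ext t
        simp only [b]
        rw [← mul_assoc, mul_pow, ← hq, sq_abs]
      have hne0 : (ε * lam)⁻¹ ≠ 0 := by positivity
      have hbi : Integrable (fun t => b t ^ 2) := by
        rw [hb2]
        exact ((hwi.comp_mul_left' hne0).comp_sub_right t₀).const_mul _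
      have hbI : ∫ t, b t ^ 2 = ((ε ^ k)⁻¹) ^ 2 * (ε * lam * Wk) := by
        rw [hb2, integral_const_mul,
          integral_sub_right_eq_self
            (fun t => (fun y => (iteratedDeriv k w y) ^ 2) ((ε * lam)⁻¹ * t)) t₀,
          Measure.integral_comp_mul_left (fun y => (iteratedDeriv k w y) ^ 2), inv_inv, abs_of_pos (by positivity), smul_eq_mul]
      have hF2 : ∫ t in Ioo (0:ℝ) 1, (iteratedDeriv k (W ε) t) ^ 2 ≤
          (M ^ 2 + 2 * M * ((ε ^ k)⁻¹ * N)) + ((ε ^ k)⁻¹) ^ 2 * (ε * lam * Wk) := by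
        rw [← hbI]
        have := aux_sq (iteratedDeriv k U) b M _ hM hbb hbi
        simpa only [hitW] using this
      have hF3 : ε ^ (2 * k - 1) * ∫ t in Ioo (0:ℝ) 1, (iteratedDeriv k (W ε) t) ^ 2 ≤
          (ε ^ (2 * k - 1) * M ^ 2 + 2 * M * N * ε ^ (k - 1)) + lam * Wk := by
        refine (mul_le_mul_of_nonneg_left hF2 (by positivity)).trans (le_of_eq ?_)
        obtain ⟨m, rfl⟩ : ∃ m, k = m + 1 := ⟨k - 1, by omega⟩
        rw [show 2 * (m + 1) - 1 = 2 * m + 1 by omega, show m + 1 - 1 = m by omega]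
        have hεm : ε ^ m ≠ 0 := by positivity
        have e1 : ε ^ (2 * m + 1) = (ε ^ m) ^ 2 * ε := by ring
        have e2 : ε ^ (m + 1) = ε ^ m * ε := by ring
        rw [e1, e2]
        field_simp
      unfold Fe
      rw [hint]
      have hfin : lam * (2 * S + Wk) ≤ sInf (mkSet k) * lam + δ / 2 := by
        have h1 : 2 * S + Wk ≤ sInf (mkSet k) + 3 * η := by linarith
        have h2 := mul_le_mul_of_nonneg_left h1 hlam0.le
        have h3 : lam * (3 * η) = δ / 2 := by
          rw [hη]; field_simp; norm_num
        linarith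
      linarith
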